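/- Assume e₁ ≠ e₂ and that S generates M as a group. A monoid homomorphism x : (S, +) → (K, ·) satisfies x*y = y*x for every monoid homomorphism y : (S, +) → (K, ·) if and only if the following two conditions hold: (i) x(u) = 0 for every u ∈ S with ⟨p, u⟩ ≠ 0, and (ii) x(u + e₁) = x(u + e₂) for every u ∈ S with ⟨p, u⟩ = 1 (note that u + e₁ and u + e₂ lie in S for such u). -/

import Mathlib

open Finset

/-- The monoid `S = σ∨ ∩ M` of lattice points of the dual cone: elements `u ∈ M` with
`⟨p_j, u⟩ ≥ 0` for all `j`. -/
def dualS {M : Type*} [AddCommGroup M] {m : ℕ} (p : Fin (m + 1) → (M →+ ℤ)) :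
    AddSubmonoid M where
  carrier := {u | ∀ j, 0 ≤ p j u}
  zero_mem' := fun j => by simp
  add_mem' := fun {u v} hu hv j => by
    rw [map_add]; exact add_nonneg (hu j) (hv j)

/-- A point of the affine toric variety `X_σ`: a monoid homomorphism `(S, +) → (K, ·)`. -/
def IsPoint {K M : Type*} [Field K] [AddCommGroup M] {m : ℕ}
    (p : Fin (m + 1) → (M →+ ℤ)) (x : dualS p → K) : Prop :=
  x 0 = 1 ∧ ∀ u v : dualS p, x (u + v) = x u * x v

open Classical in
/-- Extension of a function on `S` to all of `M` by zero. -/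
noncomputable def extend {K M : Type*} [Field K] [AddCommGroup M] {m : ℕ}
    (p : Fin (m + 1) → (M →+ ℤ)) (x : dualS p → K) : M → K :=
  fun v => if h : v ∈ dualS p then x ⟨v, h⟩ else 0

/-- `e` is a Demazure root corresponding to the distinguished ray spanned by `p 0`:
`⟨p 0, e⟩ = −1` and `⟨p j, e⟩ ≥ 0` for all other `j`. -/
def IsDemazureRoot {M : Type*} [AddCommGroup M] {m : ℕ}
    (p : Fin (m + 1) → (M →+ ℤ)) (e : M) : Prop :=
  p 0 e = -1 ∧ ∀ j, j ≠ 0 → 0 ≤ p j e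

/-- The product of two points:
`(x*y)(u) = Σ_{i+j=⟨p,u⟩} C(⟨p,u⟩,i) · x(u + i·e₂) · y(u + j·e₁)`. -/
noncomputable def prodPt {K M : Type*} [Field K] [AddCommGroup M] {m : ℕ}
    (p : Fin (m + 1) → (M →+ ℤ)) (e₁ e₂ : M) (x y : dualS p → K) : dualS p → K :=
  fun u => ∑ i ∈ Finset.range ((p 0 (u : M)).toNat + 1),
    ((p 0 (u : M)).toNat.choose i : K) *
      extend p x ((u : M) + i • e₂) *
      extend p y ((u : M) + ((p 0 (u : M)).toNat - i) • e₁)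

/-- The identity element `x_ρ` : `x_ρ(u) = 1` if `⟨p, u⟩ = 0` and `0` otherwise. -/
noncomputable def xrho {K M : Type*} [Field K] [AddCommGroup M] {m : ℕ}
    (p : Fin (m + 1) → (M →+ ℤ)) : dualS p → K :=
  fun u => if p 0 (u : M) = 0 then 1 else 0

section Points

variable {K M : Type*} [Field K] [AddCommGroup M] {m : ℕ} {p : Fin (m + 1) → (M →+ ℤ)}

theorem extend_of_mem (x : dualS p → K) {v : M} (hv : v ∈ dualS p) :
    extend p x v = x ⟨v, hv⟩ :=
  dif_pos hv

theorem extend_coe (x : dualS p → K) (u : dualS p) : extend p x u = x u :=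
  extend_of_mem x u.2

theorem extend_eq_zero {x : dualS p → K} {v : M} (h : ∀ hv : v ∈ dualS p, x ⟨v, hv⟩ = 0) :
    extend p x v = 0 := by
  by_cases hv : v ∈ dualS p
  · rw [extend_of_mem x hv, h]
  · exact dif_neg hv

theorem IsDemazureRoot.add_nsmul_mem {e : M} (he : IsDemazureRoot p e) {u : M}
    (hu : u ∈ dualS p) {n : ℕ} (hn : (n : ℤ) ≤ p 0 u) : u + n • e ∈ dualS p := by
  intro j
  rw [map_add, map_nsmul]
  rcases eq_or_ne j 0 with rfl | hj
  · rw [he.1]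
    simpa using hn
  · exact add_nonneg (hu j) (nsmul_nonneg (he.2 j hj) n)

theorem IsDemazureRoot.map_add_nsmul {e : M} (he : IsDemazureRoot p e) (u : M) (n : ℕ) :
    p 0 (u + n • e) = p 0 u - n := by
  rw [map_add, map_nsmul, he.1]
  simp [sub_eq_add_neg]

theorem Finset.sum_range_succ_eq_add_of_eq_zero {A : Type*} [AddCommMonoid A] {d : ℕ}
    (hd : 0 < d) (f : ℕ → A) (hf : ∀ i, 0 < i → i < d → f i = 0) :
    ∑ i ∈ range (d + 1), f i = f 0 + f d := by
  obtain ⟨n, rfl⟩ := Nat.exists_eq_succ_of_ne_zero hd.ne'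
  rw [Finset.sum_range_succ, Finset.sum_range_succ', Finset.sum_eq_zero, zero_add]
  intro i hi
  exact hf _ i.succ_pos (Nat.succ_lt_succ (Finset.mem_range.1 hi))

/-- If `x` vanishes in all levels strictly between `0` and `d`, only the extreme terms of
`(x*y)(u)` survive for `u` of level `d`. -/
theorem prodPt_apply_of_left_eq_zero {e₁ e₂ : M} (he₂ : IsDemazureRoot p e₂)
    (x y : dualS p → K) {d : ℕ} (hd : 0 < d) (u : dualS p) (hu : p 0 (u : M) = d)
    (hx : ∀ v : dualS p, 0 < p 0 (v : M) → p 0 (v : M) < d → x v = 0) :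
    prodPt p e₁ e₂ x y u =
      x u * extend p y (u + d • e₁) + extend p x (u + d • e₂) * y u := by
  have hx' : ∀ i : ℕ, 0 < i → i < d → extend p x (u + i • e₂) = 0 := fun i h0 hi =>
    extend_eq_zero fun hv => hx _
      (by simp only [he₂.map_add_nsmul]; omega) (by simp only [he₂.map_add_nsmul]; omega)
  simp only [prodPt, hu, Int.toNat_natCast]
  rw [Finset.sum_range_succ_eq_add_of_eq_zero hd]
  · simp [extend_coe]
  · intro i h0 hi
    simp [hx' i h0 hi]

/-- The analogue of `prodPt_apply_of_left_eq_zero` for `(y*x)(u)`. -/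
theorem prodPt_apply_of_right_eq_zero {e₁ e₂ : M} (he₁ : IsDemazureRoot p e₁)
    (x y : dualS p → K) {d : ℕ} (hd : 0 < d) (u : dualS p) (hu : p 0 (u : M) = d)
    (hx : ∀ v : dualS p, 0 < p 0 (v : M) → p 0 (v : M) < d → x v = 0) :
    prodPt p e₁ e₂ y x u =
      y u * extend p x (u + d • e₁) + extend p y (u + d • e₂) * x u := by
  have hx' : ∀ i : ℕ, 0 < i → i < d → extend p x (u + (d - i) • e₁) = 0 := fun i h0 hi =>
    extend_eq_zero fun hv => hx _
      (by simp only [he₁.map_add_nsmul]; omega) (by simp only [he₁.map_add_nsmul]; omega)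
  simp only [prodPt, hu, Int.toNat_natCast]
  rw [Finset.sum_range_succ_eq_add_of_eq_zero hd]
  · simp [extend_coe]
  · intro i h0 hi
    simp [hx' i h0 hi]

theorem prodPt_apply_of_eq_zero (e₁ e₂ : M) (x y : dualS p → K) (u : dualS p)
    (hu : p 0 (u : M) = 0) : prodPt p e₁ e₂ x y u = x u * y u := by
  simp [prodPt, hu, extend_coe]

/-- Agreement of the two root translations in level `1` propagates to every level. -/
theorem extend_add_nsmul_eq {e₁ e₂ : M} (he₁ : IsDemazureRoot p e₁)
    (he₂ : IsDemazureRoot p e₂) {x : dualS p → K}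
    (h : ∀ u : dualS p, p 0 (u : M) = 1 → extend p x (u + e₁) = extend p x (u + e₂))
    (d : ℕ) {u : M} (hu : u ∈ dualS p) (hd : p 0 u = d) :
    extend p x (u + d • e₁) = extend p x (u + d • e₂) := by
  induction d generalizing u with
  | zero => simp
  | succ n ih =>
    have h₁ := h ⟨u + n • e₁, he₁.add_nsmul_mem hu (by omega)⟩
      (by simp only [he₁.map_add_nsmul]; omega)
    have hmem := he₂.add_nsmul_mem hu (n := 1) (by omega)
    have hval := he₂.map_add_nsmul u 1
    rw [one_nsmul] at hmem hval
    have h₂ := ih hmem (by rw [hval]; push_cast at hd ⊢; omega)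
    calc extend p x (u + (n + 1) • e₁) = extend p x (u + n • e₁ + e₁) := by
          rw [succ_nsmul, add_assoc]
      _ = extend p x (u + n • e₁ + e₂) := h₁
      _ = extend p x (u + e₂ + n • e₁) := by rw [add_right_comm]
      _ = extend p x (u + e₂ + n • e₂) := h₂
      _ = extend p x (u + (n + 1) • e₂) := by rw [succ_nsmul', add_assoc]

/-- The point of the torus given by `u ↦ 2 ^ c u`. -/
theorem isPoint_two_zpow [CharZero K] (c : M →+ ℤ) :
    IsPoint p (fun u : dualS p => (2 : K) ^ c u) :=
  ⟨by simp, fun u v => by simp [zpow_add₀ (two_ne_zero' K)]⟩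

theorem extend_sub_eq_of_commute [CharZero K] {e₁ e₂ : M} (he₁ : IsDemazureRoot p e₁)
    (he₂ : IsDemazureRoot p e₂) {x : dualS p → K}
    (h : ∀ y : dualS p → K, IsPoint p y → prodPt p e₁ e₂ x y = prodPt p e₁ e₂ y x)
    {d : ℕ} (hd : 0 < d) (u : dualS p) (hu : p 0 (u : M) = d)
    (hx : ∀ v : dualS p, 0 < p 0 (v : M) → p 0 (v : M) < d → x v = 0) (c : M →+ ℤ) :
    x u * ((2 : K) ^ (d * c e₁) - 2 ^ (d * c e₂)) =
      extend p x (u + d • e₁) - extend p x (u + d • e₂) := by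
  have key := congrFun (h _ (isPoint_two_zpow c)) u
  rw [prodPt_apply_of_left_eq_zero he₂ _ _ hd u hu hx,
    prodPt_apply_of_right_eq_zero he₁ _ _ hd u hu hx,
    extend_of_mem (fun u : dualS p => (2 : K) ^ c u) (he₁.add_nsmul_mem u.2 hu.ge),
    extend_of_mem (fun u : dualS p => (2 : K) ^ c u) (he₂.add_nsmul_mem u.2 hu.ge)] at key
  simp only [map_add, map_nsmul, nsmul_eq_mul, zpow_add₀ (two_ne_zero' K)] at key
  apply mul_left_cancel₀ (zpow_ne_zero (c u) (two_ne_zero' K))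
  linear_combination key

end Points

theorem exists_addMonoidHom_int_ne {M : Type*} [AddCommGroup M] [Module.Free ℤ M] {a b : M}
    (hab : a ≠ b) : ∃ c : M →+ ℤ, c a ≠ c b := by
  by_contra! hc
  exact hab ((Module.Free.chooseBasis ℤ M).ext_elem fun i =>
    hc ((Module.Free.chooseBasis ℤ M).coord i).toAddMonoidHom)

/-- Assume `e₁ ≠ e₂` and that `S` generates `M` as a group.  A monoid
homomorphism `x : (S, +) → (K, ·)` is central (commutes with every monoid homomorphism) iff
(i) `x(u) = 0` for every `u ∈ S` with `⟨p,u⟩ ≠ 0`, and (ii) `x(u + e₁) = x(u + e₂)` for every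
`u ∈ S` with `⟨p,u⟩ = 1` (for such `u`, `u + e₁` and `u + e₂` lie in `S`, and `extend` agrees
with `x` there). -/
theorem stmt_8 {K M : Type*} [Field K] [IsAlgClosed K] [CharZero K]
    [AddCommGroup M] [Module.Free ℤ M] [Module.Finite ℤ M] {m : ℕ}
    (p : Fin (m + 1) → (M →+ ℤ)) (e₁ e₂ : M)
    (he₁ : IsDemazureRoot p e₁) (he₂ : IsDemazureRoot p e₂)
    (hne : e₁ ≠ e₂)
    (hgen : AddSubgroup.closure (dualS p : Set M) = ⊤)
    (x : dualS p → K) (hx : IsPoint p x) :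
    (∀ y : dualS p → K, IsPoint p y →
        prodPt p e₁ e₂ x y = prodPt p e₁ e₂ y x) ↔
      ((∀ u : dualS p, p 0 (u : M) ≠ 0 → x u = 0) ∧
        (∀ u : dualS p, p 0 (u : M) = 1 →
          extend p x ((u : M) + e₁) = extend p x ((u : M) + e₂))) := by
  have hlevel : ∀ u : dualS p, p 0 (u : M) ≠ 0 →
      ∃ d : ℕ, 0 < d ∧ p 0 (u : M) = d := fun u hu =>
    ⟨(p 0 (u : M)).toNat, by have := u.2 0; omega, by have := u.2 0; omega⟩
  constructor
  · intro h
    obtain ⟨c, hc⟩ := exists_addMonoidHom_int_ne hne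
    have vanish : ∀ d : ℕ, 0 < d → ∀ u : dualS p, p 0 (u : M) = d → x u = 0 := by
      intro d
      induction d using Nat.strong_induction_on with
      | _ d ih =>
        intro hd u hu
        have hlow : ∀ v : dualS p, 0 < p 0 (v : M) → p 0 (v : M) < d → x v = 0 := by
          intro v h0 hv
          obtain ⟨k, hk, hvk⟩ := hlevel v h0.ne'
          exact ih k (by omega) hk v hvk
        have h₀ := extend_sub_eq_of_commute he₁ he₂ h hd u hu hlow 0
        have h₁ := extend_sub_eq_of_commute he₁ he₂ h hd u hu hlow c
        rw [← h₀] at h₁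
        simp only [AddMonoidHom.zero_apply, sub_self, mul_zero] at h₁
        refine (mul_eq_zero.1 h₁).resolve_right fun h₂ => hc ?_
        have h₃ : ((2 : ℚ) ^ (d * c e₁)) = 2 ^ (d * c e₂) := by
          apply Rat.cast_injective (α := K)
          simpa using sub_eq_zero.1 h₂
        have h₄ := zpow_right_injective₀ (by norm_num) (by norm_num) h₃
        exact mul_left_cancel₀ (by exact_mod_cast hd.ne') h₄
    refine ⟨fun u hu => ?_, fun u hu => ?_⟩
    · obtain ⟨d, hd, hud⟩ := hlevel u hu
      exact vanish d hd u hud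
    · have h₀ := extend_sub_eq_of_commute he₁ he₂ h one_pos u (by simpa using hu)
        (fun v h0 hv => by push_cast at hv; omega) 0
      simp only [AddMonoidHom.zero_apply, sub_self, mul_zero, one_nsmul] at h₀
      exact (sub_eq_zero.1 h₀.symm)
  · rintro ⟨h₁, h₂⟩ y -
    funext u
    by_cases hu : p 0 (u : M) = 0
    · rw [prodPt_apply_of_eq_zero _ _ _ _ _ hu, prodPt_apply_of_eq_zero _ _ _ _ _ hu, mul_comm]
    · obtain ⟨d, hd, hud⟩ := hlevel u hu
      rw [prodPt_apply_of_left_eq_zero he₂ _ _ hd u hud fun v h0 _ => h₁ v h0.ne',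
        prodPt_apply_of_right_eq_zero he₁ _ _ hd u hud fun v h0 _ => h₁ v h0.ne',
        h₁ u hu, extend_add_nsmul_eq he₁ he₂ h₂ d u.2 hud]
      ring
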